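/- Let T be a strong mixing measure-preserving transformation of a probability space (X, S, μ) and let C ⊆ S be a family of measurable sets with H_μ(C) = 0. Then T is uniformly strong mixing on C: lim_{n→∞} sup_{A,B ∈ C} |μ(A ∩ T^{-n} B) − μ(A) μ(B)| = 0. -/

import Mathlib

open MeasureTheory Filter

/-- Entropy (base 2) of the join of the sets `C 0, …, C (n-1)`: the cells of the join are
indexed by sign patterns `s : Fin n → Bool`; cells of measure zero contribute `0`. -/
noncomputable def joinEntropy {X : Type*} [MeasurableSpace X] (μ : Measure X)
    {n : ℕ} (C : Fin n → Set X) : ℝ :=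
  ∑ s : Fin n → Bool,
    -((μ (⋂ i, if s i then C i else (C i)ᶜ)).toReal *
      Real.logb 2 (μ (⋂ i, if s i then C i else (C i)ᶜ)).toReal)

/-- Entropy of a family `𝒞` of measurable sets: the supremum over all sequences of sets
from `𝒞` of `liminf (1/n) H_μ(⋁_{i<n} C_i)`. -/
noncomputable def famEntropy {X : Type*} [MeasurableSpace X] (μ : Measure X)
    (𝒞 : Set (Set X)) : ℝ :=
  ⨆ S : {f : ℕ → Set X // ∀ i, f i ∈ 𝒞},
    Filter.liminf (fun n : ℕ => joinEntropy μ (fun i : Fin n => S.1 i) / n) Filter.atTop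

/-- The mean deviation `∫ |(1/n) ∑_{i<n} 1_C(T^i x) − μ(C)| dμ` of the Birkhoff average. -/
noncomputable def birkDev {X : Type*} [MeasurableSpace X] (μ : Measure X)
    (T : X → X) (C : Set X) (n : ℕ) : ℝ :=
  ∫ x, |(∑ i ∈ Finset.range n, C.indicator (fun _ => (1 : ℝ)) (T^[i] x)) / n - (μ C).toReal| ∂μ


section helpers

variable {X : Type*} [MeasurableSpace X]

def jcell {n : ℕ} (C : Fin n → Set X) (s : Fin n → Bool) : Set X :=
  ⋂ i, if s i then C i else (C i)ᶜ

noncomputable def jdef (μ : Measure X) {n : ℕ} (C : Fin n → Set X) (D : Set X) : ℝ :=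
  ∑ s : Fin n → Bool, (μ.real (jcell C s ∩ D) * μ.real (jcell C s \ D)) / μ.real (jcell C s)

lemma nml_lower {x y : ℝ} (hx : 0 ≤ x) (hy : 0 ≤ y) :
    x * y / (x + y) ≤ Real.negMulLog x + Real.negMulLog y - Real.negMulLog (x + y) := by
  rcases hx.eq_or_lt with rfl | hx
  · simp
  rcases hy.eq_or_lt with rfl | hy
  · simp
  have hs : 0 < x + y := by positivity
  have h1 := Real.log_le_sub_one_of_pos (show 0 < x / (x + y) by positivity)
  have h2 := Real.log_le_sub_one_of_pos (show 0 < y / (x + y) by positivity)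
  rw [Real.log_div hx.ne' hs.ne'] at h1
  rw [Real.log_div hy.ne' hs.ne'] at h2
  have h3 := mul_le_mul_of_nonneg_left h1 hx.le
  have h4 := mul_le_mul_of_nonneg_left h2 hy.le
  have e1 : x * (x / (x + y) - 1) = - (x * y / (x + y)) := by field_simp; ring
  have e2 : y * (y / (x + y) - 1) = - (x * y / (x + y)) := by field_simp; ring
  have h5 : 0 ≤ x * y / (x + y) := by positivity
  simp only [Real.negMulLog]
  nlinarith

lemma nml_upper {x y : ℝ} (hx : 0 ≤ x) (hy : 0 ≤ y) :
    Real.negMulLog x + Real.negMulLog y - Real.negMulLog (x + y) ≤ x + y := by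
  rcases hx.eq_or_lt with rfl | hx
  · simpa using hy
  rcases hy.eq_or_lt with rfl | hy
  · simpa using hx.le
  have hs : 0 < x + y := by positivity
  have h1 := Real.log_le_sub_one_of_pos (show 0 < (x + y) / x by positivity)
  have h2 := Real.log_le_sub_one_of_pos (show 0 < (x + y) / y by positivity)
  rw [Real.log_div hs.ne' hx.ne'] at h1
  rw [Real.log_div hs.ne' hy.ne'] at h2
  have h3 := mul_le_mul_of_nonneg_left h1 hx.le
  have h4 := mul_le_mul_of_nonneg_left h2 hy.le
  have e1 : x * ((x + y) / x - 1) = y := by field_simp; ring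
  have e2 : y * ((x + y) / y - 1) = x := by field_simp; ring
  simp only [Real.negMulLog]
  nlinarith

lemma jcell_meas {n : ℕ} {C : Fin n → Set X} (hC : ∀ i, MeasurableSet (C i)) (s : Fin n → Bool) :
    MeasurableSet (jcell C s) := by
  refine MeasurableSet.iInter fun i => ?_
  split_ifs
  · exact hC i
  · exact (hC i).compl

lemma jcell_snoc {n : ℕ} (C : Fin (n+1) → Set X) (s : Fin n → Bool) (b : Bool) :
    jcell C (Fin.snocEquiv (fun _ => Bool) (b, s)) =
      jcell (fun i : Fin n => C i.castSucc) s ∩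
        (if b then C (Fin.last n) else (C (Fin.last n))ᶜ) := by
  ext x
  simp only [jcell, Set.mem_iInter, Set.mem_inter_iff, Fin.forall_fin_succ']
  simp [Fin.snocEquiv]

lemma sum_snoc {n : ℕ} (F : (Fin (n+1) → Bool) → ℝ) :
    ∑ s, F s = ∑ s : Fin n → Bool, (F (Fin.snocEquiv (fun _ => Bool) (true, s)) +
      F (Fin.snocEquiv (fun _ => Bool) (false, s))) := by
  rw [← (Fin.snocEquiv (fun _ : Fin (n+1) => Bool)).sum_comp, Fintype.sum_prod_type]
  simp [Finset.sum_add_distrib]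

lemma sum_jcell (μ : Measure X) [IsFiniteMeasure μ] {n : ℕ} {C : Fin n → Set X}
    (hC : ∀ i, MeasurableSet (C i)) (F : Set X) :
    ∑ s, μ.real (F ∩ jcell C s) = μ.real F := by
  induction n with
  | zero => simp [jcell]
  | succ n ih =>
    rw [sum_snoc, ← ih (C := fun i : Fin n => C i.castSucc) fun i => hC _]
    refine Finset.sum_congr rfl fun s _ => ?_
    rw [jcell_snoc, jcell_snoc]
    simp only [if_true, Bool.false_eq_true, if_false, ← Set.inter_assoc]
    rw [← Set.sdiff_eq]
    exact measureReal_inter_add_sdiff (μ := μ)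
      (s := F ∩ jcell (fun i : Fin n => C i.castSucc) s) (hC (Fin.last n))

lemma joinEntropy_eq (μ : Measure X) {n : ℕ} (C : Fin n → Set X) :
    joinEntropy μ C = (∑ s, Real.negMulLog (μ.real (jcell C s))) / Real.log 2 := by
  rw [joinEntropy, Finset.sum_div]
  refine Finset.sum_congr rfl fun s _ => ?_
  simp only [Real.negMulLog, Real.logb, jcell, Measure.real]
  ring

lemma join_step (μ : Measure X) [IsProbabilityMeasure μ] {n : ℕ} {C : Fin (n+1) → Set X}
    (hC : ∀ i, MeasurableSet (C i)) :
    joinEntropy μ (fun i : Fin n => C i.castSucc) +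
        jdef μ (fun i : Fin n => C i.castSucc) (C (Fin.last n)) / Real.log 2 ≤ joinEntropy μ C ∧
    joinEntropy μ C ≤ joinEntropy μ (fun i : Fin n => C i.castSucc) + 1 / Real.log 2 := by
  have hl : 0 < Real.log 2 := Real.log_pos (by norm_num)
  rw [joinEntropy_eq, joinEntropy_eq, ← add_div, ← add_div]
  have hsum := sum_jcell μ (C := fun i : Fin n => C i.castSucc) (fun i => hC _) Set.univ
  simp only [Set.univ_inter, probReal_univ] at hsum
  rw [sum_snoc, ← hsum, jdef, ← Finset.sum_add_distrib, ← Finset.sum_add_distrib]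
  simp only [jcell_snoc, if_true, Bool.false_eq_true, if_false, ← Set.sdiff_eq]
  constructor
  · refine div_le_div_of_nonneg_right (Finset.sum_le_sum fun s _ => ?_) hl.le
    have h := measureReal_inter_add_sdiff (μ := μ)
      (s := jcell (fun i : Fin n => C i.castSucc) s) (hC (Fin.last n))
    rw [← h]
    have := nml_lower (measureReal_nonneg (μ := μ)
      (s := jcell (fun i : Fin n => C i.castSucc) s ∩ C (Fin.last n)))
      (measureReal_nonneg (μ := μ)
      (s := jcell (fun i : Fin n => C i.castSucc) s \ C (Fin.last n)))
    linarith
  · refine div_le_div_of_nonneg_right (Finset.sum_le_sum fun s _ => ?_) hl.le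
    have h := measureReal_inter_add_sdiff (μ := μ)
      (s := jcell (fun i : Fin n => C i.castSucc) s) (hC (Fin.last n))
    rw [← h]
    have := nml_upper (measureReal_nonneg (μ := μ)
      (s := jcell (fun i : Fin n => C i.castSucc) s ∩ C (Fin.last n)))
      (measureReal_nonneg (μ := μ)
      (s := jcell (fun i : Fin n => C i.castSucc) s \ C (Fin.last n)))
    linarith

lemma join_zero (μ : Measure X) [IsProbabilityMeasure μ] (C : Fin 0 → Set X) :
    joinEntropy μ C = 0 := by
  simp [joinEntropy]

lemma join_upper (μ : Measure X) [IsProbabilityMeasure μ] (f : ℕ → Set X)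
    (hf : ∀ i, MeasurableSet (f i)) (n : ℕ) :
    joinEntropy μ (fun i : Fin n => f i) ≤ n * (1 / Real.log 2) := by
  induction n with
  | zero => simp [join_zero]
  | succ n ih =>
    have := (join_step μ (C := fun i : Fin (n+1) => f i) (fun i => hf _)).2
    simp only [Fin.val_castSucc] at this
    push_cast
    linarith

lemma join_lower (μ : Measure X) [IsProbabilityMeasure μ] (f : ℕ → Set X)
    (hf : ∀ i, MeasurableSet (f i)) (δ : ℝ)
    (hδ : ∀ n, δ ≤ jdef μ (fun i : Fin n => f i) (f n)) (n : ℕ) :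
    n * (δ / Real.log 2) ≤ joinEntropy μ (fun i : Fin n => f i) := by
  have hl : 0 < Real.log 2 := Real.log_pos (by norm_num)
  induction n with
  | zero => simp [join_zero]
  | succ n ih =>
    have := (join_step μ (C := fun i : Fin (n+1) => f i) (fun i => hf _)).1
    simp only [Fin.val_castSucc, Fin.val_last] at this
    have h2 : δ / Real.log 2 ≤ jdef μ (fun i : Fin n => f i) (f n) / Real.log 2 := by
      gcongr
      exact hδ n
    push_cast
    linarith

def greedy {α : Type*} (F : ∀ n, (Fin n → α) → α) (n : ℕ) : α :=
  F n (fun i => greedy F i.1)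
termination_by n
decreasing_by exact i.2

lemma exists_small (μ : Measure X) [IsProbabilityMeasure μ]
    (𝒞 : Set (Set X)) (h𝒞 : ∀ C ∈ 𝒞, MeasurableSet C) (hent : famEntropy μ 𝒞 = 0)
    (δ : ℝ) (hδ : 0 < δ) :
    ∃ (n : ℕ) (C : Fin n → 𝒞), ∀ D : 𝒞, jdef μ (fun i => (C i : Set X)) D < δ := by
  by_contra! H
  choose F hF using H
  have hl : 0 < Real.log 2 := Real.log_pos (by norm_num)
  have hub : ∀ S : {f : ℕ → Set X // ∀ i, f i ∈ 𝒞}, ∀ n : ℕ,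
      joinEntropy μ (fun i : Fin n => S.1 i) / n ≤ 1 / Real.log 2 := by
    intro S n
    rcases Nat.eq_zero_or_pos n with rfl | hn
    · simp; positivity
    · rw [div_le_iff₀ (by positivity), mul_comm]
      exact join_upper μ S.1 (fun i => h𝒞 _ (S.2 i)) n
  have hlb : ∀ S : {f : ℕ → Set X // ∀ i, f i ∈ 𝒞}, ∀ n : ℕ,
      0 ≤ joinEntropy μ (fun i : Fin n => S.1 i) / n := by
    intro S n
    rw [joinEntropy_eq]
    refine div_nonneg (div_nonneg (Finset.sum_nonneg fun s _ => ?_) hl.le) (Nat.cast_nonneg n)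
    exact Real.negMulLog_nonneg measureReal_nonneg measureReal_le_one
  let S : {f : ℕ → Set X // ∀ i, f i ∈ 𝒞} := ⟨fun n => ((greedy F n : 𝒞) : Set X), fun n => (greedy F n).2⟩
  have hd : ∀ n, δ ≤ jdef μ (fun i : Fin n => S.1 i) (S.1 n) := by
    intro n
    have := hF n (fun i => greedy F i)
    have e : F n (fun i => greedy F i) = greedy F n := by rw [greedy]
    rw [e] at this
    exact this
  have hlow := join_lower μ S.1 (fun i => h𝒞 _ (S.2 i)) δ hd
  have h1 : δ / Real.log 2 ≤
      liminf (fun n : ℕ => joinEntropy μ (fun i : Fin n => S.1 i) / n) atTop := by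
    refine le_liminf_of_le ?_ ?_
    · exact (isBoundedUnder_of ⟨_, hub S⟩).isCoboundedUnder_ge
    · filter_upwards [eventually_gt_atTop 0] with n hn
      rw [le_div_iff₀ (by positivity), mul_comm]
      exact hlow n
  have h2 : liminf (fun n : ℕ => joinEntropy μ (fun i : Fin n => S.1 i) / n) atTop
      ≤ famEntropy μ 𝒞 := by
    refine le_ciSup (f := fun S : {f : ℕ → Set X // ∀ i, f i ∈ 𝒞} =>
      liminf (fun n : ℕ => joinEntropy μ (fun i : Fin n => S.1 i) / n) atTop) ?_ S
    refine ⟨1 / Real.log 2, ?_⟩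
    rintro _ ⟨S, rfl⟩
    refine liminf_le_of_frequently_le (Frequently.of_forall (hub S)) ?_
    exact isBoundedUnder_of ⟨0, hlb S⟩
  have : 0 < δ / Real.log 2 := by positivity
  linarith

lemma scalar_approx {a b x y : ℝ} (ha : 0 ≤ a) (hb : 0 ≤ b) (hax : a ≤ x) (hby : b ≤ y) :
    |a - x / (x + y) * (a + b)| ≤ x * y / (x + y) := by
  have hx := ha.trans hax
  have hy := hb.trans hby
  rcases (add_nonneg hx hy).eq_or_lt with h | h
  · have : a = 0 := by linarith
    simp [← h, this]
  · have : a - x / (x + y) * (a + b) = (a * y - x * b) / (x + y) := by field_simp; ring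
    rw [this, abs_div, abs_of_pos h]
    gcongr
    rw [abs_le]
    constructor <;> nlinarith [mul_nonneg ha hy, mul_nonneg hx hb]

lemma approx (μ : Measure X) [IsProbabilityMeasure μ] {n : ℕ} {C : Fin n → Set X}
    (D : Set X) (hD : MeasurableSet D) (m : Set X → ℝ)
    (m0 : ∀ F, MeasurableSet F → 0 ≤ m F) (m1 : ∀ F, MeasurableSet F → m F ≤ μ.real F)
    (madd : ∀ F, MeasurableSet F → m F = m (F ∩ D) + m (F \ D))
    (hC : ∀ i, MeasurableSet (C i))
    (msum : m D = ∑ s, m (D ∩ jcell C s)) :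
    |m D - ∑ s, μ.real (jcell C s ∩ D) / μ.real (jcell C s) * m (jcell C s)| ≤ jdef μ C D := by
  rw [msum, ← Finset.sum_sub_distrib]
  refine (Finset.abs_sum_le_sum_abs _ _).trans (Finset.sum_le_sum fun s _ => ?_)
  have hm := jcell_meas hC s
  rw [madd _ hm, ← measureReal_inter_add_sdiff (μ := μ) (s := jcell C s) hD, Set.inter_comm D]
  exact scalar_approx (m0 _ (hm.inter hD)) (m0 _ (hm.diff hD)) (m1 _ (hm.inter hD))
    (m1 _ (hm.diff hD))

lemma main_bound (μ : Measure X) [IsProbabilityMeasure μ]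
    (T : X → X) (hT : MeasurePreserving T μ μ) {n : ℕ} {C : Fin n → Set X}
    (hC : ∀ i, MeasurableSet (C i)) {A B : Set X} (hA : MeasurableSet A) (hB : MeasurableSet B) :
    |μ.real (A ∩ T ⁻¹' B) - μ.real A * μ.real B| ≤ jdef μ C A + jdef μ C B +
      ∑ s, ∑ t, |μ.real (jcell C s ∩ T ⁻¹' (jcell C t)) -
        μ.real (jcell C s) * μ.real (jcell C t)| := by
  set c : (Fin n → Bool) → ℝ := fun s => μ.real (jcell C s ∩ A) / μ.real (jcell C s) with hc
  set d : (Fin n → Bool) → ℝ := fun s => μ.real (jcell C s ∩ B) / μ.real (jcell C s) with hd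
  have c0 : ∀ s, 0 ≤ c s := fun s => div_nonneg measureReal_nonneg measureReal_nonneg
  have d0 : ∀ s, 0 ≤ d s := fun s => div_nonneg measureReal_nonneg measureReal_nonneg
  have c1 : ∀ s, c s ≤ 1 := fun s =>
    div_le_one_of_le₀ (measureReal_mono Set.inter_subset_left) measureReal_nonneg
  have d1 : ∀ s, d s ≤ 1 := fun s =>
    div_le_one_of_le₀ (measureReal_mono Set.inter_subset_left) measureReal_nonneg
  have mean : ∀ D : Set X, μ.real D =
      ∑ s, μ.real (jcell C s ∩ D) / μ.real (jcell C s) * μ.real (jcell C s) := by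
    intro D
    rw [← sum_jcell μ hC D]
    refine Finset.sum_congr rfl fun s _ => ?_
    rw [Set.inter_comm D]
    by_cases h : μ.real (jcell C s) = 0
    · have : μ.real (jcell C s ∩ D) ≤ μ.real (jcell C s) := measureReal_mono Set.inter_subset_left
      have h' := measureReal_nonneg (μ := μ) (s := jcell C s ∩ D)
      rw [h] at this ⊢
      simp; linarith
    · field_simp
  have hTB : ∀ {F : Set X}, MeasurableSet F → MeasurableSet (T ⁻¹' F) := fun h => hT.measurable h
  have E1 := approx μ (C := C) A hA (fun F => μ.real (F ∩ T ⁻¹' B))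
    (fun F _ => measureReal_nonneg) (fun F _ => measureReal_mono Set.inter_subset_left)
    (fun F hF => by
      rw [← measureReal_inter_add_sdiff (μ := μ) (s := F ∩ T ⁻¹' B) hA, Set.inter_right_comm]
      congr 2
      ext x
      simp only [Set.mem_inter_iff, Set.mem_sdiff]
      tauto) hC
    (by
      rw [← sum_jcell μ hC]
      exact Finset.sum_congr rfl fun s _ => by rw [Set.inter_right_comm])
  have E2 := approx μ (C := C) B hB (fun F => ∑ s, c s * μ.real (jcell C s ∩ T ⁻¹' F))
    (fun F _ => Finset.sum_nonneg fun s _ => mul_nonneg (c0 s) measureReal_nonneg)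
    (fun F hF => by
      have : μ.real F = μ.real (T ⁻¹' F) := by
        rw [Measure.real, Measure.real, hT.measure_preimage hF.nullMeasurableSet]
      rw [this, ← sum_jcell μ hC (T ⁻¹' F)]
      refine Finset.sum_le_sum fun s _ => ?_
      rw [Set.inter_comm]
      exact mul_le_of_le_one_left measureReal_nonneg (c1 s))
    (fun F hF => by
      rw [← Finset.sum_add_distrib]
      refine Finset.sum_congr rfl fun s _ => ?_
      rw [← mul_add, ← measureReal_inter_add_sdiff (μ := μ) (s := jcell C s ∩ T ⁻¹' F) (hTB hB),
        Set.inter_assoc, Set.inter_sdiff_assoc, Set.preimage_inter, Set.preimage_sdiff]) hC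
    (by
      rw [Finset.sum_comm]
      refine Finset.sum_congr rfl fun s _ => ?_
      rw [← Finset.mul_sum]
      congr 1
      have := sum_jcell (μ.restrict (jcell C s) |>.map T) hC B
      have hr : ∀ F, MeasurableSet F → ((μ.restrict (jcell C s)).map T).real F =
          μ.real (jcell C s ∩ T ⁻¹' F) := by
        intro F hF
        rw [Measure.real, Measure.map_apply hT.measurable hF, Measure.restrict_apply (hTB hF),
          Set.inter_comm, Measure.real]
      rw [← hr B hB, ← this]
      exact Finset.sum_congr rfl fun t _ => hr _ (hB.inter (jcell_meas hC t)))
  have E3 : |(∑ t, d t * ∑ s, c s * μ.real (jcell C s ∩ T ⁻¹' (jcell C t))) -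
      μ.real A * μ.real B| ≤ ∑ s, ∑ t, |μ.real (jcell C s ∩ T ⁻¹' (jcell C t)) -
        μ.real (jcell C s) * μ.real (jcell C t)| := by
    have : (∑ t, d t * ∑ s, c s * μ.real (jcell C s ∩ T ⁻¹' (jcell C t))) -
      μ.real A * μ.real B = ∑ s, ∑ t, c s * d t * (μ.real (jcell C s ∩ T ⁻¹' (jcell C t)) -
        μ.real (jcell C s) * μ.real (jcell C t)) := by
      rw [mean A, mean B, Finset.sum_mul_sum]
      simp only [Finset.mul_sum]
      rw [Finset.sum_comm, ← Finset.sum_sub_distrib]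
      refine Finset.sum_congr rfl fun s _ => ?_
      rw [← Finset.sum_sub_distrib]
      refine Finset.sum_congr rfl fun t _ => ?_
      simp only [hc, hd]
      ring
    rw [this]
    refine (Finset.abs_sum_le_sum_abs _ _).trans (Finset.sum_le_sum fun s _ => ?_)
    refine (Finset.abs_sum_le_sum_abs _ _).trans (Finset.sum_le_sum fun t _ => ?_)
    rw [abs_mul, abs_of_nonneg (mul_nonneg (c0 s) (d0 t))]
    exact mul_le_of_le_one_left (abs_nonneg _) (mul_le_one₀ (c1 s) (d0 t) (d1 t))
  rw [abs_le] at *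
  constructor <;> linarith [E1.1, E1.2, E2.1, E2.2, E3.1, E3.2]

end helpers

/-- If `T` is strong mixing and `H_μ(𝒞) = 0`, then `T` is uniformly strong mixing on `𝒞`:
`sup_{A,B ∈ 𝒞} |μ(A ∩ T⁻ⁿB) − μ(A)μ(B)| → 0`. -/
theorem uniform_strong_mixing_of_zero_entropy
    {X : Type*} [MeasurableSpace X] (μ : Measure X) [IsProbabilityMeasure μ]
    (T : X → X) (hT : MeasurePreserving T μ μ)
    (hmix : ∀ A B : Set X, MeasurableSet A → MeasurableSet B →
      Tendsto (fun n : ℕ => (μ (A ∩ (T^[n]) ⁻¹' B)).toReal) atTop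
        (nhds ((μ A).toReal * (μ B).toReal)))
    (𝒞 : Set (Set X)) (h𝒞 : ∀ C ∈ 𝒞, MeasurableSet C) (hent : famEntropy μ 𝒞 = 0) :
    Tendsto
      (fun n : ℕ => ⨆ A : 𝒞, ⨆ B : 𝒞,
        |(μ ((A : Set X) ∩ (T^[n]) ⁻¹' (B : Set X))).toReal - (μ A).toReal * (μ B).toReal|)
      atTop (nhds 0) := by
  rw [Metric.tendsto_atTop]
  intro ε hε
  obtain ⟨k, C, hCD⟩ := exists_small μ 𝒞 h𝒞 hent (ε / 4) (by positivity)
  have hC : ∀ i, MeasurableSet (C i : Set X) := fun i => h𝒞 _ (C i).2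
  have hlim : Tendsto (fun n : ℕ => ∑ s, ∑ t,
      |μ.real (jcell (fun i => (C i : Set X)) s ∩ T^[n] ⁻¹' (jcell (fun i => (C i : Set X)) t)) -
        μ.real (jcell (fun i => (C i : Set X)) s) * μ.real (jcell (fun i => (C i : Set X)) t)|)
      atTop (nhds 0) := by
    have : (0 : ℝ) = ∑ s : Fin k → Bool, ∑ t : Fin k → Bool, 0 := by simp
    rw [this]
    refine tendsto_finsetSum _ fun s _ => tendsto_finsetSum _ fun t _ => ?_
    have h := hmix _ _ (jcell_meas hC s) (jcell_meas hC t)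
    have h2 := (h.sub_const ((μ (jcell (fun i => (C i : Set X)) s)).toReal *
      (μ (jcell (fun i => (C i : Set X)) t)).toReal)).abs
    simpa [Measure.real] using h2
  obtain ⟨N, hN⟩ := eventually_atTop.1 (hlim.eventually (gt_mem_nhds (show 0 < ε / 4 by positivity)))
  refine ⟨N, fun n hn => ?_⟩
  have hle : (⨆ A : 𝒞, ⨆ B : 𝒞,
      |(μ ((A : Set X) ∩ (T^[n]) ⁻¹' (B : Set X))).toReal - (μ A).toReal * (μ B).toReal|)
      ≤ 3 * (ε / 4) := by
    refine Real.iSup_le (fun A => Real.iSup_le (fun B => ?_) (by positivity)) (by positivity)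
    have := main_bound μ (T^[n]) (hT.iterate n) hC (h𝒞 _ A.2) (h𝒞 _ B.2)
    have h1 := hCD A
    have h2 := hCD B
    have h3 := hN n hn
    simp only [Measure.real] at *
    linarith
  have hge : 0 ≤ (⨆ A : 𝒞, ⨆ B : 𝒞,
      |(μ ((A : Set X) ∩ (T^[n]) ⁻¹' (B : Set X))).toReal - (μ A).toReal * (μ B).toReal|) :=
    Real.iSup_nonneg fun A => Real.iSup_nonneg fun B => abs_nonneg _
  rw [Real.dist_0_eq_abs, abs_of_nonneg hge]
  linarith
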